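/- arXiv:1302.6970 — 6 statements merged into one kernel-verified Lean document; each statement's English description precedes it below -/
import Mathlib

section
/- Let V be a finite-dimensional real inner product space with inner product g, let ω be a nondegenerate alternating bilinear form on V, let A_g be the unique linear endomorphism with ω(x,y) = g(A_g x,y) for all x,y, let P_g := (A_g A_g*)^{1/2} and J_g := P_g⁻¹ ∘ A_g. Then J_g is a complex structure (J_g² = −id), J_g is g-orthogonal (g(J_g x, J_g y) = g(x,y) for all x,y, equivalently J_g* = J_g⁻¹ = −J_g), and P_g ∘ J_g = J_g ∘ P_g = A_g. -/
open scoped RealInnerProductSpace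

/-- With `A_g` the endomorphism representing `ω` with respect to `g`,
`P_g = (A_g A_g*)^{1/2}` (characterized as the unique self-adjoint positive-definite
square root of `A_g A_g*`) and `J_g = P_g⁻¹ ∘ A_g` (characterized by `P_g ∘ J_g = A_g`,
as `P_g` is invertible), the map `J_g` is a complex structure, is `g`-orthogonal
(`J_g* = J_g⁻¹ = -J_g`), and `P_g ∘ J_g = J_g ∘ P_g = A_g`. -/
theorem polar_complex_structure
    {V : Type*} [NormedAddCommGroup V] [InnerProductSpace ℝ V] [FiniteDimensional ℝ V]
    (ω : V →ₗ[ℝ] V →ₗ[ℝ] ℝ)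
    (hω_alt : ∀ x : V, ω x x = 0)
    (hω_nondeg : ∀ x : V, (∀ y : V, ω x y = 0) → x = 0)
    (A P J : V →ₗ[ℝ] V)
    (hA : ∀ x y : V, ω x y = ⟪A x, y⟫)
    (hP_sa : LinearMap.adjoint P = P)
    (hP_pos : ∀ x : V, x ≠ 0 → 0 < ⟪P x, x⟫)
    (hP_sq : P * P = A * LinearMap.adjoint A)
    (hJ : P * J = A) :
    J * J = -1 ∧
    (∀ x y : V, ⟪J x, J y⟫ = ⟪x, y⟫) ∧
    LinearMap.adjoint J = -J ∧
    LinearMap.adjoint J * J = 1 ∧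
    P * J = A ∧ J * P = A := by
  have inj : ∀ x : V, P x = 0 → x = 0 := by
    intro x hx
    by_contra h
    have := hP_pos x h
    rw [hx, inner_zero_left] at this
    exact lt_irrefl _ this
  have cancel : ∀ S T : V →ₗ[ℝ] V, P * S = P * T → S = T := by
    intro S T h
    ext x
    have h1 : P (S x) = P (T x) := LinearMap.congr_fun h x
    exact sub_eq_zero.mp (inj _ (by rw [map_sub, h1, sub_self]))
  have hskew : ∀ x y : V, ⟪A x, y⟫ = -⟪A y, x⟫ := by
    intro x y
    have h := hω_alt (x + y)
    simp only [map_add, LinearMap.add_apply, hω_alt] at h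
    rw [← hA, ← hA]
    linarith
  have hAadj : LinearMap.adjoint A = -A := by
    symm
    rw [LinearMap.eq_adjoint_iff]
    intro x y
    rw [LinearMap.neg_apply, inner_neg_left, hskew x y, neg_neg, real_inner_comm]
  rw [hAadj] at hP_sq
  have hPs : ∀ x y : V, ⟪P x, y⟫ = ⟪x, P y⟫ := by
    intro x y
    conv_lhs => rw [← hP_sa]
    exact LinearMap.adjoint_inner_left P y x
  have hPP : P * P = -(A * A) := by rw [hP_sq]; simp
  have hAP : A * P = P * A := by
    have hsym : (A * P - P * A).IsSymmetric := by
      intro x y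
      simp only [LinearMap.sub_apply, Module.End.mul_apply, inner_sub_left, inner_sub_right]
      have h1 := hskew (P x) y
      have h2 := hPs (A x) y
      have h3 := hskew x (P y)
      have h4 := hPs x (A y)
      have e1 := real_inner_comm (P x) (A y)
      have e2 := real_inner_comm x (A (P y))
      linarith
    have hanti : P * (A * P - P * A) + (A * P - P * A) * P = 0 := by
      have : P * (A * P - P * A) + (A * P - P * A) * P = A * (P * P) - (P * P) * A := by
        noncomm_ring
      rw [this, hPP]
      noncomm_ring
    rw [← sub_eq_zero]
    set C := A * P - P * A with hC
    apply (hsym.eigenvectorBasis rfl).toBasis.ext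
    intro i
    have hev := hsym.apply_eigenvectorBasis rfl i
    rw [OrthonormalBasis.coe_toBasis]
    set v := hsym.eigenvectorBasis rfl i with hv
    have hv0 : v ≠ 0 := by
      intro h0
      have := (hsym.eigenvectorBasis rfl).orthonormal.1 i
      rw [← hv, h0, norm_zero] at this
      exact zero_ne_one this
    have h1 : P (C v) + C (P v) = 0 := LinearMap.congr_fun hanti v
    have h2 : ⟪P (C v) + C (P v), v⟫ = 0 := by rw [h1, inner_zero_left]
    rw [inner_add_left, hsym (P v) v, hev, map_smul, real_inner_smul_right] at h2
    erw [real_inner_smul_left] at h2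
    have hpos := hP_pos v hv0
    rw [hev, LinearMap.zero_apply]
    have h3 : hsym.eigenvalues rfl i * ⟪P v, v⟫ = 0 := by
      simp only [RCLike.ofReal_real_eq_id, id] at h2
      linarith
    rcases mul_eq_zero.mp h3 with h | h
    · rw [h]; simp
    · exact absurd h hpos.ne'
  have hJP : J * P = A := by
    apply cancel
    rw [← mul_assoc, hJ, hAP]
  have hJJ : J * J = -1 := by
    apply cancel
    apply cancel
    calc P * (P * (J * J)) = P * ((P * J) * J) := by noncomm_ring
      _ = P * ((J * P) * J) := by rw [hJ, hJP]
      _ = (P * J) * (P * J) := by noncomm_ring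
      _ = A * A := by rw [hJ]
      _ = P * (P * -1) := by
        rw [mul_neg, mul_neg, mul_one, hPP, neg_neg]
  have hJadj : LinearMap.adjoint J = -J := by
    apply cancel
    have h : LinearMap.adjoint (J * P) = LinearMap.adjoint P * LinearMap.adjoint J :=
      LinearMap.adjoint_comp J P
    rw [hJP, hAadj, hP_sa] at h
    rw [← h, mul_neg, hJ]
  have hJ1 : LinearMap.adjoint J * J = 1 := by
    rw [hJadj, neg_mul, hJJ, neg_neg]
  refine ⟨hJJ, ?_, hJadj, hJ1, hJ, hJP⟩
  intro x y
  rw [← LinearMap.adjoint_inner_right]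
  have h : LinearMap.adjoint J (J y) = y := LinearMap.congr_fun hJ1 y
  rw [h]
end

section
/- Let V be a finite-dimensional real inner product space with inner product g, let ω be a nondegenerate alternating bilinear form on V, let A_g be the unique linear endomorphism with ω(x,y) = g(A_g x,y) for all x,y, let P_g := (A_g A_g*)^{1/2} and J_g := P_g⁻¹ ∘ A_g. Then the bilinear form r(g)(x,y) := ω(x, J_g y) satisfies r(g)(x,y) = g(P_g x, y) for all x,y; in particular r(g) is a symmetric positive-definite inner product on V, and (ω, J_g, r(g)) is a compatible triple, i.e. ω(x,y) = r(g)(J_g x, y) for all x,y ∈ V. -/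
open scoped RealInnerProductSpace

/-- With `A_g`, `P_g`, `J_g` as in the polar-decomposition construction,
the bilinear form `r(g)(x,y) = ω(x, J_g y)` equals `g(P_g x, y)`; in particular it is
a symmetric positive-definite inner product and `(ω, J_g, r(g))` is a compatible
triple, i.e. `ω(x,y) = r(g)(J_g x, y)`. -/
theorem polar_retraction_metric
    {V : Type*} [NormedAddCommGroup V] [InnerProductSpace ℝ V] [FiniteDimensional ℝ V]
    (ω : V →ₗ[ℝ] V →ₗ[ℝ] ℝ)
    (hω_alt : ∀ x : V, ω x x = 0)
    (hω_nondeg : ∀ x : V, (∀ y : V, ω x y = 0) → x = 0)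
    (A P J : V →ₗ[ℝ] V)
    (hA : ∀ x y : V, ω x y = ⟪A x, y⟫)
    (hP_sa : LinearMap.adjoint P = P)
    (hP_pos : ∀ x : V, x ≠ 0 → 0 < ⟪P x, x⟫)
    (hP_sq : P * P = A * LinearMap.adjoint A)
    (hJ : P * J = A) :
    (∀ x y : V, ω x (J y) = ⟪P x, y⟫) ∧
    (∀ x y : V, ω x (J y) = ω y (J x)) ∧
    (∀ x : V, x ≠ 0 → 0 < ω x (J x)) ∧
    (∀ x y : V, ω x y = ω (J x) (J y)) := by
  have hP' : ∀ x y, ⟪P x, y⟫ = ⟪x, P y⟫ := fun x y => by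
    rw [← LinearMap.adjoint_inner_right, hP_sa]
  have hskew : ∀ x y, ω x y = - ω y x := fun x y => by
    have h := hω_alt (x + y)
    simp only [map_add, LinearMap.add_apply, hω_alt] at h
    linarith
  have hAs : ∀ x y, ⟪A x, y⟫ = - ⟪x, A y⟫ := fun x y => by
    rw [← hA, hskew, hA, real_inner_comm]
  have hAadj : ∀ y, LinearMap.adjoint A y = - A y := fun y => by
    refine ext_inner_left ℝ fun x => ?_
    rw [LinearMap.adjoint_inner_right, hAs, inner_neg_right]
  have hPP : ∀ x, P (P x) = - A (A x) := fun x => by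
    have h := LinearMap.congr_fun hP_sq x
    simpa [hAadj] using h
  have hPJ : ∀ x, P (J x) = A x := fun x => LinearMap.congr_fun hJ x
  have hinj : ∀ x, P x = 0 → x = 0 := fun x hx => by
    by_contra h
    have := hP_pos x h
    simp [hx] at this
  have hC : (P * A - A * P).IsSymmetric := fun x y => by
    simp only [LinearMap.sub_apply, Module.End.mul_apply, inner_sub_left, inner_sub_right]
    rw [hP', hAs, hAs, hP']
    ring
  have hanti : ∀ x, P ((P * A - A * P) x) = - (P * A - A * P) (P x) := fun x => by
    simp only [LinearMap.sub_apply, Module.End.mul_apply, map_sub, hPP, map_neg]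
    abel
  have hC0 : P * A - A * P = 0 := by
    refine (hC.eigenvectorBasis rfl).toBasis.ext fun i => ?_
    have hne : hC.eigenvectorBasis rfl i ≠ 0 :=
      (hC.eigenvectorBasis rfl).orthonormal.ne_zero i
    have he := hC.apply_eigenvectorBasis rfl i
    simp only [OrthonormalBasis.coe_toBasis, LinearMap.zero_apply]
    generalize hC.eigenvectorBasis rfl i = v at *
    have h1 := hC (P v) v
    have h2 := congrArg (fun z => ⟪z, v⟫) (hanti v)
    simp only [inner_neg_left] at h2
    rw [h1, he, map_smul, inner_smul_left, inner_smul_right] at h2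
    have hp := hP_pos v hne
    have h3 : hC.eigenvalues rfl i * ⟪P v, v⟫ = 0 := by
      simp at h2
      linarith
    rcases mul_eq_zero.mp h3 with h | h
    · rw [he, h]; simp
    · exact absurd h hp.ne'
  have hcomm : ∀ x, P (A x) = A (P x) := fun x => by
    have h := LinearMap.congr_fun hC0 x
    exact sub_eq_zero.mp h
  have hAJ : ∀ x, A (J x) = - P x := fun x => by
    have h : P (A (J x) + P x) = 0 := by
      rw [map_add, hcomm, hPJ, hPP]; abel
    exact eq_neg_of_add_eq_zero_left (hinj _ h)
  have main : ∀ x y : V, ω x (J y) = ⟪P x, y⟫ := fun x y => by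
    rw [hA, hAs, hAJ, inner_neg_right, neg_neg, hP']
  refine ⟨main, fun x y => ?_, fun x hx => ?_, fun x y => ?_⟩
  · rw [main, main, hP', real_inner_comm]
  · rw [main]; exact hP_pos x hx
  · rw [main, hPJ, hA]
end

section
/- Let V be a finite-dimensional real inner product space with inner product g, let ω be a nondegenerate alternating bilinear form on V, let A_g be the unique linear endomorphism with ω(x,y) = g(A_g x,y) for all x,y, let P_g := (A_g A_g*)^{1/2} and J_g := P_g⁻¹ ∘ A_g. Then J_g preserves ω: ω(J_g x, J_g y) = ω(x,y) for all x,y ∈ V. -/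
open scoped RealInnerProductSpace

/-- With `A_g`, `P_g`, `J_g` as in the polar-decomposition construction,
the almost complex structure `J_g` preserves `ω`: `ω(J_g x, J_g y) = ω(x,y)`. -/
theorem polar_complex_structure_preserves_omega
    {V : Type*} [NormedAddCommGroup V] [InnerProductSpace ℝ V] [FiniteDimensional ℝ V]
    (ω : V →ₗ[ℝ] V →ₗ[ℝ] ℝ)
    (hω_alt : ∀ x : V, ω x x = 0)
    (hω_nondeg : ∀ x : V, (∀ y : V, ω x y = 0) → x = 0)
    (A P J : V →ₗ[ℝ] V)
    (hA : ∀ x y : V, ω x y = ⟪A x, y⟫)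
    (hP_sa : LinearMap.adjoint P = P)
    (hP_pos : ∀ x : V, x ≠ 0 → 0 < ⟪P x, x⟫)
    (hP_sq : P * P = A * LinearMap.adjoint A)
    (hJ : P * J = A) :
    ∀ x y : V, ω (J x) (J y) = ω x y := by
  have hsa : ∀ x y : V, ⟪P x, y⟫ = ⟪x, P y⟫ := by
    intro x y
    conv_rhs => rw [← hP_sa]
    rw [LinearMap.adjoint_inner_right]
  have hskew : ∀ x y : V, ⟪A x, y⟫ = -⟪x, A y⟫ := by
    intro x y
    have h := hω_alt (x + y)
    simp only [map_add, LinearMap.add_apply, hω_alt] at h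
    rw [hA, hA, real_inner_comm x (A y)] at h
    linarith
  have hadj : LinearMap.adjoint A = -A := by
    symm
    rw [LinearMap.eq_adjoint_iff]
    intro x y
    rw [LinearMap.neg_apply, inner_neg_left, hskew, neg_neg]
  have hsq : ∀ x, P (P x) = -A (A x) := by
    intro x
    have h := LinearMap.congr_fun hP_sq x
    simpa [hadj] using h
  have hinj : Function.Injective P := by
    rw [injective_iff_map_eq_zero]
    intro x hx
    by_contra hne
    have h := hP_pos x hne
    rw [hx, inner_zero_left] at h
    exact lt_irrefl _ h
  have hsurj : Function.Surjective P := LinearMap.injective_iff_surjective.mp hinj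
  have hsym : P.IsSymmetric := hsa
  have hcomm : P * A - A * P = 0 := by
    refine (hsym.eigenvectorBasis rfl).toBasis.ext fun i => ?_
    have hv := hsym.apply_eigenvectorBasis rfl i
    have hv0 : hsym.eigenvectorBasis rfl i ≠ 0 :=
      (hsym.eigenvectorBasis rfl).orthonormal.ne_zero i
    simp only [OrthonormalBasis.coe_toBasis, LinearMap.zero_apply]
    generalize hsym.eigenvectorBasis rfl i = v at hv hv0 ⊢
    generalize hsym.eigenvalues rfl i = m at hv
    have hv' : P v = m • v := hv
    have hm : 0 < m := by
      have h := hP_pos v hv0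
      rw [hv', real_inner_smul_left] at h
      exact pos_of_mul_pos_left h real_inner_self_nonneg
    by_contra hne
    have h := hP_pos _ hne
    have hPC : P ((P * A - A * P) v) = -(m • ((P * A - A * P) v)) := by
      have h1 : A (P (P v)) = P (P (A v)) := by simp [hsq]
      simp only [LinearMap.sub_apply, Module.End.mul_apply, map_sub]
      rw [← h1]
      simp only [hv', map_smul]
      module
    rw [hPC, inner_neg_left, real_inner_smul_left] at h
    have := mul_nonneg hm.le (real_inner_self_nonneg (x := (P * A - A * P) v))
    linarith
  have hPA : ∀ x, P (A x) = A (P x) := fun x => by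
    have h := LinearMap.congr_fun hcomm x
    simpa [sub_eq_zero] using h
  have hPJ : ∀ x, P (J x) = A x := fun x => LinearMap.congr_fun hJ x
  have hJP : ∀ x, J (P x) = A x := fun x => hinj (by rw [hPJ, hPA])
  intro x y
  obtain ⟨z, rfl⟩ := hsurj y
  rw [hA, hA, hJP, ← hsa, ← neg_neg ⟪A (J x), A z⟫, ← hskew, ← inner_neg_left, ← hsq, hPJ]
end

section
/- Let V be a finite-dimensional real inner product space with inner product g and let ω be a nondegenerate alternating bilinear form on V. Suppose g is ω-compatible, i.e. there exists a complex structure J' on V (J'² = −id) such that (ω, J', g) is a compatible triple (ω(x,y) = g(J'x,y) for all x,y). Let A_g be the unique endomorphism with ω(x,y) = g(A_g x,y), P_g := (A_g A_g*)^{1/2}, J_g := P_g⁻¹ A_g, and r(g)(x,y) := ω(x, J_g y). Then A_g = J', P_g = id, J_g = J', and r(g) = g. (In other words, the map g ↦ r(g) is a retraction onto the set of ω-compatible inner products.) -/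
open scoped RealInnerProductSpace

/-- If `g` is `ω`-compatible, i.e. there is a complex structure `J'`
with `ω(x,y) = g(J' x, y)`, then in the polar-decomposition construction one has
`A_g = J'`, `P_g = id`, `J_g = J'` and `r(g) = g`; so `g ↦ r(g)` is a retraction
onto the set of `ω`-compatible inner products. -/
theorem polar_retraction_fixes_compatible
    {V : Type*} [NormedAddCommGroup V] [InnerProductSpace ℝ V] [FiniteDimensional ℝ V]
    (ω : V →ₗ[ℝ] V →ₗ[ℝ] ℝ)
    (hω_alt : ∀ x : V, ω x x = 0)
    (hω_nondeg : ∀ x : V, (∀ y : V, ω x y = 0) → x = 0)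
    (J' : V →ₗ[ℝ] V)
    (hJ'_sq : ∀ x : V, J' (J' x) = -x)
    (hJ'_compat : ∀ x y : V, ω x y = ⟪J' x, y⟫)
    (A P J : V →ₗ[ℝ] V)
    (hA : ∀ x y : V, ω x y = ⟪A x, y⟫)
    (hP_sa : LinearMap.adjoint P = P)
    (hP_pos : ∀ x : V, x ≠ 0 → 0 < ⟪P x, x⟫)
    (hP_sq : P * P = A * LinearMap.adjoint A)
    (hJ : P * J = A) :
    A = J' ∧ P = 1 ∧ J = J' ∧ (∀ x y : V, ω x (J y) = ⟪x, y⟫) := by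
  have hskew : ∀ x y : V, ω x y = - ω y x := by
    intro x y
    have h := hω_alt (x + y)
    simp only [map_add, LinearMap.add_apply, hω_alt] at h
    linarith
  have hAJ : A = J' := by
    ext x
    refine ext_inner_right ℝ fun y => ?_
    rw [← hA, ← hJ'_compat]
  subst hAJ
  have hadj : ∀ x : V, LinearMap.adjoint A x = - A x := by
    intro x
    refine ext_inner_right ℝ fun y => ?_
    rw [LinearMap.adjoint_inner_left, inner_neg_left, ← hA, real_inner_comm, ← hA, hskew]
  have hPP : ∀ x : V, P (P x) = x := by
    intro x
    have h := LinearMap.congr_fun hP_sq x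
    simpa [hadj, hJ'_sq] using h
  have hP1 : P = 1 := by
    ext x
    by_contra hne
    have hy : P x - x ≠ 0 := fun h => hne (by simpa using sub_eq_zero.mp h)
    have h := hP_pos _ hy
    have h2 : P (P x - x) = -(P x - x) := by rw [map_sub, hPP]; abel
    rw [h2, inner_neg_left] at h
    have h3 : 0 ≤ ⟪P x - x, P x - x⟫ := real_inner_self_nonneg
    linarith
  have hJA : J = A := by rw [← hJ, hP1, one_mul]
  refine ⟨rfl, hP1, hJA, fun x y => ?_⟩
  rw [hJA, hskew, hA, hJ'_sq, inner_neg_left, neg_neg, real_inner_comm]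
end

section
/- Let V be a finite-dimensional real inner product space with inner product g, let ω be a nondegenerate alternating bilinear form on V, let A_g be the unique endomorphism with ω(x,y) = g(A_g x,y) for all x,y, let P_g := (A_g A_g*)^{1/2}, J_g := P_g⁻¹ A_g, and r(g)(x,y) := ω(x, J_g y). If T : V → V is a linear automorphism that is both g-orthogonal (g(Tx,Ty) = g(x,y)) and a symplectomorphism of (V,ω) (ω(Tx,Ty) = ω(x,y)), then T commutes with A_g, with P_g, and with J_g, and T is also r(g)-orthogonal: r(g)(Tx,Ty) = r(g)(x,y) for all x,y ∈ V. -/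
open scoped RealInnerProductSpace

/-- Uniqueness of positive-definite symmetric square roots. -/
theorem polar_sqrt_unique
    {V : Type*} [NormedAddCommGroup V] [InnerProductSpace ℝ V] [FiniteDimensional ℝ V]
    (P Q : V →ₗ[ℝ] V) (hP : P.IsSymmetric) (hQ : Q.IsSymmetric)
    (hPp : ∀ x : V, x ≠ 0 → 0 < ⟪P x, x⟫) (hQp : ∀ x : V, x ≠ 0 → 0 < ⟪Q x, x⟫)
    (h : ∀ x, P (P x) = Q (Q x)) : P = Q := by
  have hD : (P - Q).IsSymmetric := hP.sub hQ
  have key : ∀ (l : ℝ) (x : V), x ≠ 0 → (P - Q) x = l • x → l = 0 := by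
    intro l x hx hl
    have h1 : ⟪P ((P - Q) x), x⟫ = l * ⟪P x, x⟫ := by
      rw [hl, map_smul, real_inner_smul_left]
    have h2 : ⟪(P - Q) (Q x), x⟫ = l * ⟪Q x, x⟫ := by
      rw [hD, hl, real_inner_smul_right]
    have h3 : P ((P - Q) x) + (P - Q) (Q x) = 0 := by
      simp [h x]
    have h4 : l * (⟪P x, x⟫ + ⟪Q x, x⟫) = 0 := by
      rw [mul_add, ← h1, ← h2, ← inner_add_left, h3, inner_zero_left]
    rcases mul_eq_zero.mp h4 with h5 | h5
    · exact h5
    · linarith [hPp x hx, hQp x hx]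
  apply sub_eq_zero.mp
  apply (hD.eigenvectorBasis rfl).toBasis.ext
  intro i
  have e := hD.apply_eigenvectorBasis rfl i
  have z := key _ _ ((hD.eigenvectorBasis rfl).orthonormal.ne_zero i) e
  rw [OrthonormalBasis.coe_toBasis, e, z]
  simp

/-- With `A_g`, `P_g`, `J_g`, `r(g)` as in the polar-decomposition
construction, a linear automorphism `T` that is both `g`-orthogonal and a
symplectomorphism of `(V, ω)` commutes with `A_g`, `P_g` and `J_g`, and is
`r(g)`-orthogonal, where `r(g)(x,y) = ω(x, J_g y)`. -/
theorem polar_retraction_equivariance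
    {V : Type*} [NormedAddCommGroup V] [InnerProductSpace ℝ V] [FiniteDimensional ℝ V]
    (ω : V →ₗ[ℝ] V →ₗ[ℝ] ℝ)
    (hω_alt : ∀ x : V, ω x x = 0)
    (hω_nondeg : ∀ x : V, (∀ y : V, ω x y = 0) → x = 0)
    (A P J : V →ₗ[ℝ] V)
    (hA : ∀ x y : V, ω x y = ⟪A x, y⟫)
    (hP_sa : LinearMap.adjoint P = P)
    (hP_pos : ∀ x : V, x ≠ 0 → 0 < ⟪P x, x⟫)
    (hP_sq : P * P = A * LinearMap.adjoint A)
    (hJ : P * J = A)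
    (T : V ≃ₗ[ℝ] V)
    (hTg : ∀ x y : V, ⟪T x, T y⟫ = ⟪x, y⟫)
    (hTω : ∀ x y : V, ω (T x) (T y) = ω x y) :
    (∀ x : V, T (A x) = A (T x)) ∧
    (∀ x : V, T (P x) = P (T x)) ∧
    (∀ x : V, T (J x) = J (T x)) ∧
    (∀ x y : V, ω (T x) (J (T y)) = ω x (J y)) := by
  have ext' : ∀ a b : V, (∀ y, ⟪a, T y⟫ = ⟪b, T y⟫) → a = b := by
    intro a b h
    refine ext_inner_right ℝ fun v => ?_
    have := h (T.symm v)
    rwa [T.apply_symm_apply] at this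
  have hTA : ∀ x : V, T (A x) = A (T x) := by
    intro x
    refine ext' _ _ fun y => ?_
    rw [hTg, ← hA, ← hA, hTω]
  have hTA' : ∀ x : V, T (LinearMap.adjoint A x) = LinearMap.adjoint A (T x) := by
    intro x
    refine ext' _ _ fun y => ?_
    rw [hTg, LinearMap.adjoint_inner_left, LinearMap.adjoint_inner_left, ← hTA, hTg]
  have hPs : P.IsSymmetric := fun x y => by
    rw [← LinearMap.adjoint_inner_left, hP_sa]
  have hPP : ∀ x, P (P x) = A (LinearMap.adjoint A x) := fun x =>
    LinearMap.congr_fun hP_sq x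
  have hPJ : ∀ x, P (J x) = A x := fun x => LinearMap.congr_fun hJ x
  have hQi : ∀ x y : V, ⟪T.symm x, y⟫ = ⟪x, T y⟫ := fun x y => by
    rw [← hTg, T.apply_symm_apply]
  let Q : V →ₗ[ℝ] V := T.symm.toLinearMap ∘ₗ P ∘ₗ T.toLinearMap
  have hQ : ∀ x, Q x = T.symm (P (T x)) := fun x => rfl
  have hPQ : P = Q := by
    refine polar_sqrt_unique P Q hPs ?_ hP_pos ?_ ?_
    · intro x y
      rw [hQ, hQ, hQi, hPs, real_inner_comm _ x, hQi, real_inner_comm]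
    · intro x hx
      rw [hQ, hQi]
      exact hP_pos _ (by simpa using hx)
    · intro x
      rw [hQ, hQ, T.apply_symm_apply, hPP, hPP, ← hTA', ← hTA, T.symm_apply_apply]
  have hTP : ∀ x : V, T (P x) = P (T x) := by
    intro x
    conv_lhs => rw [hPQ]
    rw [hQ, T.apply_symm_apply]
  have hPinj : ∀ x y, P x = P y → x = y := by
    intro x y h
    by_contra hne
    have := hP_pos (x - y) (sub_ne_zero.mpr hne)
    rw [map_sub, h, sub_self, inner_zero_left] at this
    exact lt_irrefl _ this
  have hTJ : ∀ x : V, T (J x) = J (T x) := by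
    intro x
    apply hPinj
    rw [← hTP, hPJ, hPJ, hTA]
  refine ⟨hTA, hTP, hTJ, fun x y => ?_⟩
  rw [← hTJ, hTω]
end

section
/- Let V be a finite-dimensional real inner product space. On the open set of invertible linear endomorphisms of V, the maps A ↦ (A A*)^{1/2} and A ↦ ((A A*)^{1/2})⁻¹ ∘ A (the two factors of the polar decomposition of A) are smooth (C^∞). -/
open scoped RealInnerProductSpace

lemma sylvester_aux {V : Type*} [NormedAddCommGroup V] [InnerProductSpace ℝ V]
    [FiniteDimensional ℝ V] (S T H : V →L[ℝ] V)
    (hS : ∀ x : V, x ≠ 0 → 0 < ⟪S x, x⟫)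
    (hT : ∀ x : V, x ≠ 0 → 0 < ⟪T x, x⟫)
    (hTs : ContinuousLinearMap.adjoint T = T)
    (h : S * H + H * T = 0) : H = 0 := by
  have hsym : (T : V →ₗ[ℝ] V).IsSymmetric := by
    intro x y
    have := ContinuousLinearMap.adjoint_inner_left T y x
    rw [hTs] at this
    exact this
  have hb := hsym.apply_eigenvectorBasis rfl
  have key : (H : V →ₗ[ℝ] V) = 0 := by
    apply (hsym.eigenvectorBasis rfl).toBasis.ext
    intro i
    set v := hsym.eigenvectorBasis rfl i with hv
    have hTv : T v = (hsym.eigenvalues rfl i) • v := hb i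
    have hv1 : ‖v‖ = 1 := (hsym.eigenvectorBasis rfl).orthonormal.1 i
    have hv0 : v ≠ 0 := by
      intro h0
      rw [h0] at hv1
      simp at hv1
    have hpos := hT v hv0
    rw [hTv, real_inner_smul_left, real_inner_self_eq_norm_sq, hv1] at hpos
    have hl : 0 < hsym.eigenvalues rfl i := by simpa using hpos
    have e : S (H v) + H (T v) = 0 := by
      have := congrArg (fun L : V →L[ℝ] V => L v) h
      simpa using this
    rw [hTv, map_smul] at e
    have e2 : S (H v) = -((hsym.eigenvalues rfl i) • H v) := eq_neg_of_add_eq_zero_left e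
    have goal : H v = 0 := by
      by_contra hne
      have h1 := hS _ hne
      rw [e2, inner_neg_left, real_inner_smul_left, real_inner_self_eq_norm_sq] at h1
      nlinarith [sq_nonneg ‖H v‖]
    simpa [← hv] using goal
  ext x
  exact congrArg (fun L : V →ₗ[ℝ] V => L x) key

lemma posdef_open_aux {V : Type*} [NormedAddCommGroup V] [InnerProductSpace ℝ V]
    [FiniteDimensional ℝ V] (S : V →L[ℝ] V)
    (hS : ∀ x : V, x ≠ 0 → 0 < ⟪S x, x⟫) :
    ∀ᶠ T in nhds S, ∀ x : V, x ≠ 0 → 0 < ⟪T x, x⟫ := by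
  have hc : IsCompact (Metric.sphere (0 : V) 1) := isCompact_sphere 0 1
  have h1 : ∀ᶠ T in nhds S, ∀ x ∈ Metric.sphere (0 : V) 1, 0 < ⟪T x, x⟫ := by
    apply hc.eventually_forall_of_forall_eventually
    intro x hx
    have hcont : Continuous (fun z : (V →L[ℝ] V) × V => ⟪z.1 z.2, z.2⟫) := by fun_prop
    have hx0 : x ≠ 0 := by
      rintro rfl
      simp at hx
    exact hcont.continuousAt.eventually (lt_mem_nhds (hS x hx0))
  filter_upwards [h1] with T hT x hx
  have hn : 0 < ‖x‖ := norm_pos_iff.mpr hx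
  have := hT (‖x‖⁻¹ • x) (by simp [norm_smul, hn.ne'])
  rw [map_smul, real_inner_smul_left, real_inner_smul_right] at this
  have hi : 0 < ‖x‖⁻¹ := inv_pos.mpr hn
  exact (mul_pos_iff_of_pos_left hi).mp ((mul_pos_iff_of_pos_left hi).mp this)

lemma adjoint_contDiff_aux {V : Type*} [NormedAddCommGroup V] [InnerProductSpace ℝ V]
    [FiniteDimensional ℝ V] {n : WithTop ℕ∞} :
    ContDiff ℝ n (fun A : V →L[ℝ] V => ContinuousLinearMap.adjoint A) := by
  apply IsBoundedLinearMap.contDiff (𝕜 := ℝ)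
  refine ⟨⟨fun x y => map_add _ x y, fun c x => ?_⟩, 1, one_pos, fun x => ?_⟩
  · simp
  · simp

lemma sqrt_contDiffAt_aux {V : Type*} [NormedAddCommGroup V] [InnerProductSpace ℝ V]
    [FiniteDimensional ℝ V]
    (sqrt : (V →L[ℝ] V) → (V →L[ℝ] V))
    (hsqrt : ∀ A : V →L[ℝ] V, IsUnit A →
      ContinuousLinearMap.adjoint (sqrt A) = sqrt A ∧
      (∀ x : V, x ≠ 0 → 0 < ⟪(sqrt A) x, x⟫) ∧
      sqrt A * sqrt A = A * ContinuousLinearMap.adjoint A)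
    (A : V →L[ℝ] V) (hA : IsUnit A) : ContDiffAt ℝ (⊤ : ℕ∞) sqrt A := by
  obtain ⟨hs, hp, hm⟩ := hsqrt A hA
  set S := sqrt A with hSdef
  let f : (V →L[ℝ] V) → (V →L[ℝ] V) := fun X => X * X
  have hf : ContDiffAt ℝ (⊤ : ℕ∞) f S := (contDiff_id.mul contDiff_id).contDiffAt
  let D : (V →L[ℝ] V) →L[ℝ] (V →L[ℝ] V) :=
    ContinuousLinearMap.mul ℝ (V →L[ℝ] V) S + (ContinuousLinearMap.mul ℝ (V →L[ℝ] V)).flip S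
  have hD : ∀ H, D H = S * H + H * S := fun H => by simp [D]
  have hinj : Function.Injective (D : (V →L[ℝ] V) →ₗ[ℝ] (V →L[ℝ] V)) := by
    rw [injective_iff_map_eq_zero]
    intro H hH
    exact sylvester_aux S S H hp hp hs ((hD H).symm.trans hH)
  let e : (V →L[ℝ] V) ≃L[ℝ] (V →L[ℝ] V) :=
    (LinearEquiv.ofInjectiveEndo (D : (V →L[ℝ] V) →ₗ[ℝ] (V →L[ℝ] V)) hinj).toContinuousLinearEquiv
  have hfd : HasFDerivAt f (e : (V →L[ℝ] V) →L[ℝ] (V →L[ℝ] V)) S := by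
    have h1 := (hasFDerivAt_id (𝕜 := ℝ) S).mul' (hasFDerivAt_id (𝕜 := ℝ) S)
    refine h1.congr_fderiv ?_
    apply ContinuousLinearMap.ext
    intro H
    have : e H = D H := rfl
    simp [this, hD]
  have hn : ((⊤ : ℕ∞) : WithTop ℕ∞) ≠ 0 := by simp
  let P := hf.toOpenPartialHomeomorph f hfd hn
  have hPf : ∀ X, P X = X * X := fun X => rfl
  have hSs : S ∈ P.source := hf.mem_toOpenPartialHomeomorph_source hfd hn
  have hg : ContDiffAt ℝ (⊤ : ℕ∞) P.symm (f S) := hf.to_localInverse hfd hn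
  have hq : ContDiff ℝ (⊤ : ℕ∞) (fun A : V →L[ℝ] V => A * ContinuousLinearMap.adjoint A) :=
    contDiff_id.mul adjoint_contDiff_aux
  have hfS : f S = A * ContinuousLinearMap.adjoint A := hm
  have hcomp : ContDiffAt ℝ (⊤ : ℕ∞)
      (fun A : V →L[ℝ] V => P.symm (A * ContinuousLinearMap.adjoint A)) A := by
    rw [hfS] at hg
    exact ContDiffAt.comp A hg hq.contDiffAt
  refine hcomp.congr_of_eventuallyEq ?_
  have hval : P.symm (A * ContinuousLinearMap.adjoint A) = S := by
    rw [← hfS]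
    exact P.left_inv hSs
  have ht : ∀ᶠ B in nhds A, B * ContinuousLinearMap.adjoint B ∈ P.target := by
    apply hq.continuous.continuousAt.eventually_mem
    apply P.open_target.mem_nhds
    rw [← hfS]
    exact P.map_source hSs
  have hpos : ∀ᶠ B in nhds A, ∀ x : V, x ≠ 0 →
      0 < ⟪(P.symm (B * ContinuousLinearMap.adjoint B)) x, x⟫ := by
    have := posdef_open_aux S hp
    rw [← hval] at this
    exact hcomp.continuousAt.eventually this
  have hu : ∀ᶠ B in nhds A, IsUnit B := Units.isOpen.mem_nhds hA
  filter_upwards [ht, hpos, hu] with B hBt hBp hBu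
  obtain ⟨b1, b2, b3⟩ := hsqrt B hBu
  set R := P.symm (B * ContinuousLinearMap.adjoint B)
  have hR : R * R = B * ContinuousLinearMap.adjoint B := P.right_inv hBt
  have := sylvester_aux R (sqrt B) (R - sqrt B) hBp b2 b1 (by
    rw [mul_sub, sub_mul, hR, b3]
    abel)
  exact (sub_eq_zero.mp this).symm

/-- On the open set of invertible (continuous) linear endomorphisms of a
finite-dimensional real inner product space, the two factors of the polar decomposition,
`A ↦ (A A*)^{1/2}` and `A ↦ ((A A*)^{1/2})⁻¹ ∘ A`, are smooth. Here the square root map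
is characterized pointwise as the unique self-adjoint positive-definite square root of
`A A*`. -/
theorem polar_decomposition_smooth
    {V : Type*} [NormedAddCommGroup V] [InnerProductSpace ℝ V] [FiniteDimensional ℝ V]
    (sqrt : (V →L[ℝ] V) → (V →L[ℝ] V))
    (hsqrt : ∀ A : V →L[ℝ] V, IsUnit A →
      ContinuousLinearMap.adjoint (sqrt A) = sqrt A ∧
      (∀ x : V, x ≠ 0 → 0 < ⟪(sqrt A) x, x⟫) ∧
      sqrt A * sqrt A = A * ContinuousLinearMap.adjoint A) :
    ContDiffOn ℝ (⊤ : ℕ∞) sqrt {A : V →L[ℝ] V | IsUnit A} ∧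
    ContDiffOn ℝ (⊤ : ℕ∞) (fun A : V →L[ℝ] V => Ring.inverse (sqrt A) * A)
      {A : V →L[ℝ] V | IsUnit A} := by
  have h1 := sqrt_contDiffAt_aux sqrt hsqrt
  refine ⟨fun A hA => (h1 A hA).contDiffWithinAt, fun A hA => ?_⟩
  apply ContDiffAt.contDiffWithinAt
  have hA' : IsUnit A := hA
  obtain ⟨hs, hp, hm⟩ := hsqrt A hA
  have hu : IsUnit (sqrt A) := by
    have hstar : IsUnit (ContinuousLinearMap.adjoint A) := by
      rw [← ContinuousLinearMap.star_eq_adjoint]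
      exact hA'.star
    have h2 : IsUnit (sqrt A * sqrt A) := hm ▸ hA'.mul hstar
    exact ((Commute.refl (sqrt A)).isUnit_mul_iff.mp h2).1
  obtain ⟨u, hu⟩ := hu
  have hi : ContDiffAt ℝ (⊤ : ℕ∞) Ring.inverse (sqrt A) := by
    rw [← hu]
    exact contDiffAt_ringInverse ℝ u
  exact (ContDiffAt.comp A hi (h1 A hA)).mul contDiffAt_id
end
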